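/- Let n ≥ 2. If T is an n-consistent theory extending Peano arithmetic PA whose deductive closure (i.e., the set of Gödel numbers of T-provable sentences) is definable in ℕ by a Πₙ-formula, then there exists a Π_{n−1}-sentence γ that is independent of T, i.e., T ⊬ γ and T ⊬ ¬γ. -/

import Mathlib

/-!
Formalization of results from "Gödel–Rosser's Incompleteness Theorems for
non-RE Theories" (Salehi & Seraji).

We work in the first-order language of arithmetic `{0, S, +, ×, ≤}` with the
standard model `ℕ`.  Provability `T ⊢ φ` is rendered as the semantic
consequence `T ⊨ᵇ φ` of Mathlib's model theory library, which by the Gödel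
completeness theorem coincides with provability in first-order logic.
-/

open FirstOrder Language BoundedFormula

namespace GRNonRE

/-- Function symbols of arithmetic: `0`, `S`, `+`, `×`. -/
inductive ArithFunc : ℕ → Type
  | zero : ArithFunc 0
  | succ : ArithFunc 1
  | add  : ArithFunc 2
  | mul  : ArithFunc 2

/-- The relation symbol `≤`. -/
inductive ArithRel : ℕ → Type
  | le : ArithRel 2

/-- The first-order language of arithmetic `{0, S, +, ×, ≤}`. -/
def LA : FirstOrder.Language := ⟨ArithFunc, ArithRel⟩

/-- The standard model `ℕ`. -/
instance : LA.Structure ℕ where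
  funMap {_} f := match f with
    | ArithFunc.zero => fun _ => 0
    | ArithFunc.succ => fun v => v 0 + 1
    | ArithFunc.add  => fun v => v 0 + v 1
    | ArithFunc.mul  => fun v => v 0 * v 1
  RelMap {_} r := match r with
    | ArithRel.le => fun v => v 0 ≤ v 1

def zeroT {α : Type} : LA.Term α := Term.func ArithFunc.zero ![]
def succT {α : Type} (t : LA.Term α) : LA.Term α := Term.func ArithFunc.succ ![t]
def addT {α : Type} (t s : LA.Term α) : LA.Term α := Term.func ArithFunc.add ![t, s]
def mulT {α : Type} (t s : LA.Term α) : LA.Term α := Term.func ArithFunc.mul ![t, s]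

/-- The atomic formula `t ≤ s`. -/
def leF {α : Type} {n : ℕ} (t s : LA.Term (α ⊕ Fin n)) : LA.BoundedFormula α n :=
  BoundedFormula.rel ArithRel.le ![t, s]

/-- The numeral `m̄ = S (S ⋯ (S 0))` representing `m : ℕ`. -/
def numeral : ℕ → LA.Term Empty
  | 0 => zeroT
  | n + 1 => succT (numeral n)

instance : Encodable (Σ n, LA.Functions n) :=
  ⟨fun f => match f with
    | ⟨_, ArithFunc.zero⟩ => 0
    | ⟨_, ArithFunc.succ⟩ => 1
    | ⟨_, ArithFunc.add⟩ => 2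
    | ⟨_, ArithFunc.mul⟩ => 3,
   fun n => match n with
    | 0 => some ⟨0, ArithFunc.zero⟩
    | 1 => some ⟨1, ArithFunc.succ⟩
    | 2 => some ⟨2, ArithFunc.add⟩
    | 3 => some ⟨2, ArithFunc.mul⟩
    | _ => none,
   by rintro ⟨n, f⟩; cases f <;> rfl⟩

instance : Encodable (Σ n, LA.Relations n) :=
  ⟨fun _ => 0,
   fun n => match n with
    | 0 => some ⟨2, ArithRel.le⟩
    | _ => none,
   by rintro ⟨n, r⟩; cases r; rfl⟩

/-- A standard Gödel numbering of formulas, obtained from Mathlib's structural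
encoding of bounded formulas as lists of symbols. -/
def godel {k : ℕ} (φ : LA.BoundedFormula Empty k) : ℕ :=
  Encodable.encode φ.listEncode

/-- Lift a term in context `k` to context `k + 1`. -/
def liftT {k : ℕ} (t : LA.Term (Empty ⊕ Fin k)) : LA.Term (Empty ⊕ Fin (k + 1)) :=
  t.relabel (Sum.map id Fin.castSucc)

/-- The class `Σ₀ = Π₀ = Δ₀` of bounded formulas: built from atomic formulas by
Boolean connectives (`⊥` and `⟹`, from which `∼`, `⊓`, `⊔` are definable) and
bounded universal quantification `∀ x ≤ t, φ` (bounded existential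
quantification `∃ x ≤ t, φ` is expressible as `∼ ∀ x ≤ t, ∼φ`). -/
inductive Delta0 : ∀ {k : ℕ}, LA.BoundedFormula Empty k → Prop
  | falsum {k : ℕ} : Delta0 (⊥ : LA.BoundedFormula Empty k)
  | equal {k : ℕ} (t₁ t₂ : LA.Term (Empty ⊕ Fin k)) : Delta0 (t₁ =' t₂)
  | le {k : ℕ} (t₁ t₂ : LA.Term (Empty ⊕ Fin k)) : Delta0 (leF t₁ t₂)
  | imp {k : ℕ} {φ ψ : LA.BoundedFormula Empty k} :
      Delta0 φ → Delta0 ψ → Delta0 (φ ⟹ ψ)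
  | bdall {k : ℕ} (t : LA.Term (Empty ⊕ Fin k)) {φ : LA.BoundedFormula Empty (k + 1)} :
      Delta0 φ → Delta0 ((leF (&(Fin.last k)) (liftT t) ⟹ φ).all)

mutual
  /-- The classes `Σₙ` of the arithmetical hierarchy: `Σ₀` is the class of
  bounded formulas, and `Σ_{n+1}` contains `Πₙ` and is closed under `⊓`, `⊔`,
  existential quantification and bounded universal quantification. -/
  inductive IsSigma : ℕ → ∀ {k : ℕ}, LA.BoundedFormula Empty k → Prop
    | ofDelta0 {k : ℕ} {φ : LA.BoundedFormula Empty k} : Delta0 φ → IsSigma 0 φ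
    | ofPi {n k : ℕ} {φ : LA.BoundedFormula Empty k} :
        IsPi n φ → IsSigma (n + 1) φ
    | ex {n k : ℕ} {φ : LA.BoundedFormula Empty (k + 1)} :
        IsSigma (n + 1) φ → IsSigma (n + 1) φ.ex
    | inf {n k : ℕ} {φ ψ : LA.BoundedFormula Empty k} :
        IsSigma (n + 1) φ → IsSigma (n + 1) ψ → IsSigma (n + 1) (φ ⊓ ψ)
    | sup {n k : ℕ} {φ ψ : LA.BoundedFormula Empty k} :
        IsSigma (n + 1) φ → IsSigma (n + 1) ψ → IsSigma (n + 1) (φ ⊔ ψ)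
    | bdall {n k : ℕ} (t : LA.Term (Empty ⊕ Fin k))
        {φ : LA.BoundedFormula Empty (k + 1)} :
        IsSigma (n + 1) φ → IsSigma (n + 1) ((leF (&(Fin.last k)) (liftT t) ⟹ φ).all)

  /-- The classes `Πₙ` of the arithmetical hierarchy: `Π₀` is the class of
  bounded formulas, and `Π_{n+1}` contains `Σₙ` and is closed under `⊓`, `⊔`,
  universal quantification and bounded existential quantification. -/
  inductive IsPi : ℕ → ∀ {k : ℕ}, LA.BoundedFormula Empty k → Prop
    | ofDelta0 {k : ℕ} {φ : LA.BoundedFormula Empty k} : Delta0 φ → IsPi 0 φ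
    | ofSigma {n k : ℕ} {φ : LA.BoundedFormula Empty k} :
        IsSigma n φ → IsPi (n + 1) φ
    | all {n k : ℕ} {φ : LA.BoundedFormula Empty (k + 1)} :
        IsPi (n + 1) φ → IsPi (n + 1) φ.all
    | inf {n k : ℕ} {φ ψ : LA.BoundedFormula Empty k} :
        IsPi (n + 1) φ → IsPi (n + 1) ψ → IsPi (n + 1) (φ ⊓ ψ)
    | sup {n k : ℕ} {φ ψ : LA.BoundedFormula Empty k} :
        IsPi (n + 1) φ → IsPi (n + 1) ψ → IsPi (n + 1) (φ ⊔ ψ)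
    | bdex {n k : ℕ} (t : LA.Term (Empty ⊕ Fin k))
        {φ : LA.BoundedFormula Empty (k + 1)} :
        IsPi (n + 1) φ → IsPi (n + 1) ((leF (&(Fin.last k)) (liftT t) ⊓ φ).ex)
end

/-- `T ⊢ φ`: by the Gödel completeness theorem, provability of the sentence `φ`
from the theory `T` coincides with the semantic consequence relation. -/
def Proves (T : LA.Theory) (φ : LA.Sentence) : Prop := T ⊨ᵇ φ

/-- Consistency of a theory. -/
def Consistent (T : LA.Theory) : Prop := ¬ Proves T ⊥

/-- `ψ(m̄)`: the result of substituting the numeral `m̄` for the free variable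
of a formula `ψ(x)` with one free variable. -/
def subst1 (ψ : LA.BoundedFormula Empty 1) (m : ℕ) : LA.Sentence :=
  ψ.toFormula.subst fun _ => numeral m

/-- `n`-consistency: there is no formula `ψ(x) ∈ Π_{n-1}` such that `T ⊢ ¬ψ(m̄)`
for every numeral `m̄` (`m ∈ ℕ`) and yet `T ⊢ ∃x ψ(x)`.
(`0`-consistency is ordinary consistency.) -/
def NCon : ℕ → LA.Theory → Prop
  | 0, T => Consistent T
  | n + 1, T => ¬ ∃ ψ : LA.BoundedFormula Empty 1, IsPi n ψ ∧
      (∀ m : ℕ, Proves T (∼(subst1 ψ m))) ∧ Proves T ψ.ex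

/-- The axioms of Robinson arithmetic `Q`:
`Sx ≠ 0`, `Sx = Sy → x = y`, `x ≠ 0 → ∃y x = Sy`, `x + 0 = x`,
`x + Sy = S(x + y)`, `x·0 = 0`, `x·Sy = x·y + x`, `x ≤ y ↔ ∃z z + x = y`. -/
def QTheory : LA.Theory :=
  { ∀' ∼(succT (&0) =' zeroT),
    ∀' ∀' ((succT (&0) =' succT (&1)) ⟹ (&0 =' &1)),
    ∀' (∼(&0 =' zeroT) ⟹ ∃' (&0 =' succT (&1))),
    ∀' (addT (&0) zeroT =' &0),
    ∀' ∀' (addT (&0) (succT (&1)) =' succT (addT (&0) (&1))),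
    ∀' (mulT (&0) zeroT =' zeroT),
    ∀' ∀' (mulT (&0) (succT (&1)) =' addT (mulT (&0) (&1)) (&0)),
    ((leF (&0) (&1) ⇔ ∃' (addT (&2) (&0) =' (&1)) : LA.BoundedFormula Empty 2)).alls }

/-- `T` is an extension of Robinson arithmetic `Q` (i.e. `T` proves `Q`). -/
def ExtendsQ (T : LA.Theory) : Prop := ∀ φ ∈ QTheory, Proves T φ

/-- `Πₙ-Th(ℕ)`: the set of `Πₙ`-sentences true in the standard model. -/
def PiTh (n : ℕ) : LA.Theory := {φ | IsPi n φ ∧ ℕ ⊨ φ}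

/-- Soundness: every theorem of `T` is true in `ℕ`. -/
def Sound (T : LA.Theory) : Prop := ∀ φ : LA.Sentence, Proves T φ → ℕ ⊨ φ

/-- `Σₙ`-soundness: every `Σₙ`-sentence provable in `T` is true in `ℕ`. -/
def SigmaSound (n : ℕ) (T : LA.Theory) : Prop :=
  ∀ φ : LA.Sentence, IsSigma n φ → Proves T φ → ℕ ⊨ φ

/-- A formula `Ψ(x)` with one free variable defines the set `A ⊆ ℕ` in `ℕ`. -/
def Defines (Ψ : LA.BoundedFormula Empty 1) (A : Set ℕ) : Prop :=
  ∀ m : ℕ, m ∈ A ↔ Ψ.Realize (fun e => Empty.elim e) ![m]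

/-- `A ⊆ ℕ` is definable in `ℕ` by a `Σₙ`-formula. -/
def SigmaDefinable (n : ℕ) (A : Set ℕ) : Prop := ∃ Ψ, IsSigma n Ψ ∧ Defines Ψ A

/-- `A ⊆ ℕ` is definable in `ℕ` by a `Πₙ`-formula. -/
def PiDefinable (n : ℕ) (A : Set ℕ) : Prop := ∃ Ψ, IsPi n Ψ ∧ Defines Ψ A

/-- The set of Gödel numbers of the axioms of `T`. -/
def axiomCodes (T : LA.Theory) : Set ℕ := {m | ∃ φ ∈ T, godel φ = m}

/-- The set of Gödel numbers of the theorems of `T` (its deductive closure). -/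
def theoremCodes (T : LA.Theory) : Set ℕ := {m | ∃ φ, Proves T φ ∧ godel φ = m}

/-- Substitute the closed term `t` for the last (de Bruijn) variable. -/
def substLast {k : ℕ} (φ : LA.BoundedFormula Empty (k + 1)) (t : LA.Term Empty) :
    LA.BoundedFormula Empty k :=
  (φ.toFormula.subst
    (Sum.elim (fun e => Empty.elim e)
      (fun i : Fin (k + 1) =>
        if h : (i : ℕ) < k then Term.var ⟨i, h⟩
        else t.relabel (fun e => Empty.elim e)))).relabel Sum.inr

/-- Substitute `S x` for the last (de Bruijn) variable `x`. -/
def succLast {k : ℕ} (φ : LA.BoundedFormula Empty (k + 1)) :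
    LA.BoundedFormula Empty (k + 1) :=
  (φ.toFormula.subst
    (Sum.elim (fun e => Empty.elim e)
      (fun i : Fin (k + 1) =>
        if (i : ℕ) < k then Term.var i else succT (Term.var i)))).relabel Sum.inr

/-- The induction axiom for `φ(x₀, …, x_{k-1}, x)`, inducting on the last
variable: `∀ x̄ ((φ(x̄, 0) ∧ ∀x (φ(x̄, x) → φ(x̄, Sx))) → ∀x φ(x̄, x))`. -/
def indAx {k : ℕ} (φ : LA.BoundedFormula Empty (k + 1)) : LA.Sentence :=
  ((substLast φ zeroT ⊓ (φ ⟹ succLast φ).all) ⟹ φ.all).alls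

/-- Peano arithmetic `PA`: Robinson arithmetic together with the induction
axiom scheme for all formulas. -/
def PATheory : LA.Theory :=
  QTheory ∪ {σ | ∃ (k : ℕ) (φ : LA.BoundedFormula Empty (k + 1)), σ = indAx φ}

/-! ### Satisfaction in structures for the language of arithmetic -/

section Semantics

variable {M : Type} [LA.Structure M]

/-- The interpretation of `0`. -/
def zeroM (M : Type) [LA.Structure M] : M := Structure.funMap (L := LA) ArithFunc.zero ![]
/-- The interpretation of `S`. -/
def succM (x : M) : M := Structure.funMap (L := LA) ArithFunc.succ ![x]
/-- The interpretation of `+`. -/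
def addM (x y : M) : M := Structure.funMap (L := LA) ArithFunc.add ![x, y]
/-- The interpretation of `×`. -/
def mulM (x y : M) : M := Structure.funMap (L := LA) ArithFunc.mul ![x, y]
/-- The interpretation of `≤`. -/
def leM (x y : M) : Prop := Structure.RelMap (L := LA) ArithRel.le ![x, y]

/-- The value of a term whose variables are interpreted by `v`. -/
def tval {k : ℕ} (t : LA.Term (Empty ⊕ Fin k)) (v : Fin k → M) : M :=
  t.realize (Sum.elim (fun e => Empty.elim e) v)

/-- Satisfaction of a formula under the assignment `v`. -/
def Sat {k : ℕ} (φ : LA.BoundedFormula Empty k) (v : Fin k → M) : Prop :=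
  φ.Realize (fun e => Empty.elim e) v

variable {k : ℕ} {φ ψ : LA.BoundedFormula Empty k} {θ : LA.BoundedFormula Empty (k + 1)}
  {v : Fin k → M}

@[simp] theorem tval_var (i : Fin k) : tval (&i) v = v i := rfl

@[simp] theorem tval_inr (i : Fin k) :
    tval (Term.var (Sum.inr i) : LA.Term (Empty ⊕ Fin k)) v = v i := rfl

@[simp] theorem tval_zeroT : tval zeroT v = zeroM M := by
  simp only [tval, zeroT, Term.realize, zeroM]; congr 1; ext i; exact i.elim0

@[simp] theorem tval_succT (t : LA.Term (Empty ⊕ Fin k)) :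
    tval (succT t) v = succM (tval t v) := by
  simp only [tval, succT, Term.realize, succM]; congr 1; ext i; fin_cases i; rfl

@[simp] theorem tval_addT (t s : LA.Term (Empty ⊕ Fin k)) :
    tval (addT t s) v = addM (tval t v) (tval s v) := by
  simp only [tval, addT, Term.realize, addM]; congr 1; ext i; fin_cases i <;> rfl

@[simp] theorem tval_mulT (t s : LA.Term (Empty ⊕ Fin k)) :
    tval (mulT t s) v = mulM (tval t v) (tval s v) := by
  simp only [tval, mulT, Term.realize, mulM]; congr 1; ext i; fin_cases i <;> rfl

@[simp] theorem tval_liftT (t : LA.Term (Empty ⊕ Fin k)) (x : M) :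
    tval (liftT t) (Fin.snoc v x) = tval t v := by
  simp only [tval, liftT, Term.realize_relabel]
  congr 1; ext i; rcases i with e | i
  · exact e.elim
  · simp

theorem tval_relabel {k' : ℕ} (f : Fin k → Fin k') (t : LA.Term (Empty ⊕ Fin k))
    (w : Fin k' → M) : tval (t.relabel (Sum.map id f)) w = tval t (w ∘ f) := by
  simp only [tval, Term.realize_relabel]
  congr 1; ext i; rcases i with e | i
  · exact e.elim
  · simp

@[simp] theorem sat_eq (t s : LA.Term (Empty ⊕ Fin k)) :
    Sat (t =' s) v ↔ tval t v = tval s v := Iff.rfl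

@[simp] theorem sat_leF (t s : LA.Term (Empty ⊕ Fin k)) :
    Sat (leF t s) v ↔ leM (tval t v) (tval s v) := by
  simp only [Sat, leF, Realize, leM, tval]
  rw [iff_eq_eq]; congr 1; ext i; fin_cases i <;> rfl

@[simp] theorem sat_imp : Sat (φ ⟹ ψ) v ↔ (Sat φ v → Sat ψ v) := Iff.rfl

@[simp] theorem sat_not : Sat (∼φ) v ↔ ¬ Sat φ v := Iff.rfl

@[simp] theorem sat_inf : Sat (φ ⊓ ψ) v ↔ Sat φ v ∧ Sat ψ v := realize_inf

@[simp] theorem sat_sup : Sat (φ ⊔ ψ) v ↔ Sat φ v ∨ Sat ψ v := realize_sup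

@[simp] theorem sat_iff : Sat (φ ⇔ ψ) v ↔ (Sat φ v ↔ Sat ψ v) := realize_iff

@[simp] theorem sat_all : Sat θ.all v ↔ ∀ x : M, Sat θ (Fin.snoc v x) := Iff.rfl

@[simp] theorem sat_ex : Sat θ.ex v ↔ ∃ x : M, Sat θ (Fin.snoc v x) := realize_ex

theorem models_iff_sat (φ : LA.Sentence) : M ⊨ φ ↔ Sat φ (default : Fin 0 → M) := by
  unfold Sentence.Realize Formula.Realize Sat
  rw [Subsingleton.elim (default : Empty → M) (fun e => Empty.elim e)]

theorem realize_iff_sat (e : Empty → M) (w : Fin k → M) : φ.Realize e w ↔ Sat φ w := by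
  unfold Sat
  rw [Subsingleton.elim e (fun e => Empty.elim e)]

end Semantics

/-! ### Renaming of variables -/

/-- The extension of a renaming below a quantifier. -/
def extRen {k k' : ℕ} (f : Fin k → Fin k') : Fin (k + 1) → Fin (k' + 1) :=
  Fin.snoc (fun i => (f i).castSucc) (Fin.last k')

theorem snoc_comp_extRen {M : Type} {k k' : ℕ} (f : Fin k → Fin k') (w : Fin k' → M) (x : M) :
    (Fin.snoc w x : Fin (k' + 1) → M) ∘ extRen f = Fin.snoc (w ∘ f) x := by
  ext i
  refine Fin.lastCases ?_ (fun i => ?_) i <;> simp [extRen]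

/-- Renaming of the variables of a formula. -/
def ren : ∀ {k k' : ℕ}, (Fin k → Fin k') → LA.BoundedFormula Empty k → LA.BoundedFormula Empty k'
  | _, _, _, falsum => falsum
  | _, _, f, equal t s => equal (t.relabel (Sum.map id f)) (s.relabel (Sum.map id f))
  | _, _, f, rel R ts => rel R fun i => (ts i).relabel (Sum.map id f)
  | _, _, f, imp φ ψ => imp (ren f φ) (ren f ψ)
  | _, _, f, all φ => all (ren (extRen f) φ)

@[simp] theorem sat_ren {M : Type} [LA.Structure M] {k k' : ℕ} (f : Fin k → Fin k')
    (φ : LA.BoundedFormula Empty k) (w : Fin k' → M) : Sat (ren f φ) w ↔ Sat φ (w ∘ f) := by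
  induction φ generalizing k' with
  | falsum => rfl
  | equal t s =>
    change tval _ w = tval _ w ↔ tval _ _ = tval _ _
    rw [tval_relabel, tval_relabel]
  | rel R ts =>
    change Structure.RelMap R (fun i => tval _ w) ↔ Structure.RelMap R (fun i => tval _ _)
    simp only [tval_relabel]
  | imp φ ψ ih₁ ih₂ => simp only [ren, sat_imp, ih₁, ih₂]
  | all φ ih => simp only [ren, sat_all, ih, snoc_comp_extRen]

theorem ren_liftT {k k' : ℕ} (f : Fin k → Fin k') (t : LA.Term (Empty ⊕ Fin k)) :
    (liftT t).relabel (Sum.map id (extRen f)) = liftT (t.relabel (Sum.map id f)) := by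
  simp only [liftT, Term.relabel_relabel]
  congr 1; ext i; rcases i with e | i
  · exact e.elim
  · simp [extRen]

theorem ren_leF {k k' : ℕ} (f : Fin k → Fin k') (t s : LA.Term (Empty ⊕ Fin k)) :
    ren f (leF t s) = leF (t.relabel (Sum.map id f)) (s.relabel (Sum.map id f)) := by
  simp only [leF, ren]; congr 1; ext i; fin_cases i <;> rfl

theorem ren_leF_last {k k' : ℕ} (f : Fin k → Fin k') (t : LA.Term (Empty ⊕ Fin k)) :
    ren (extRen f) (leF (&(Fin.last k)) (liftT t)) =
      leF (&(Fin.last k')) (liftT (t.relabel (Sum.map id f))) := by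
  rw [ren_leF, ren_liftT]
  congr 1
  simp [Term.relabel, extRen]

theorem Delta0.ren {k k' : ℕ} {φ : LA.BoundedFormula Empty k} (h : Delta0 φ)
    (f : Fin k → Fin k') : Delta0 (ren f φ) := by
  induction h generalizing k' with
  | falsum => exact .falsum
  | equal t s => exact .equal _ _
  | le t s => rw [ren_leF]; exact .le _ _
  | imp _ _ ih₁ ih₂ => exact .imp (ih₁ f) (ih₂ f)
  | bdall t _ ih =>
    have := Delta0.bdall (t.relabel (Sum.map id f)) (ih (extRen f))
    rwa [← ren_leF_last] at this

/-! ### Induction principles for the arithmetical hierarchy -/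

/-- Bounded universal quantification `∀ x ≤ t, φ`. -/
abbrev bdAll {k : ℕ} (t : LA.Term (Empty ⊕ Fin k)) (φ : LA.BoundedFormula Empty (k + 1)) :
    LA.BoundedFormula Empty k :=
  (leF (&(Fin.last k)) (liftT t) ⟹ φ).all

/-- Bounded existential quantification `∃ x ≤ t, φ`. -/
abbrev bdEx {k : ℕ} (t : LA.Term (Empty ⊕ Fin k)) (φ : LA.BoundedFormula Empty (k + 1)) :
    LA.BoundedFormula Empty k :=
  (leF (&(Fin.last k)) (liftT t) ⊓ φ).ex

theorem IsSigma.zero_iff {k : ℕ} {φ : LA.BoundedFormula Empty k} : IsSigma 0 φ ↔ Delta0 φ :=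
  ⟨fun h => by cases h; assumption, .ofDelta0⟩

theorem IsPi.zero_iff {k : ℕ} {φ : LA.BoundedFormula Empty k} : IsPi 0 φ ↔ Delta0 φ :=
  ⟨fun h => by cases h; assumption, .ofDelta0⟩

theorem IsSigma.succ_induction {j : ℕ}
    {motive : ∀ {k : ℕ}, LA.BoundedFormula Empty k → Prop}
    (ofPi : ∀ {k : ℕ} {φ : LA.BoundedFormula Empty k}, IsPi j φ → motive φ)
    (ex : ∀ {k : ℕ} {φ : LA.BoundedFormula Empty (k + 1)}, motive φ → motive φ.ex)
    (inf : ∀ {k : ℕ} {φ ψ : LA.BoundedFormula Empty k}, motive φ → motive ψ → motive (φ ⊓ ψ))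
    (sup : ∀ {k : ℕ} {φ ψ : LA.BoundedFormula Empty k}, motive φ → motive ψ → motive (φ ⊔ ψ))
    (bdall : ∀ {k : ℕ} (t : LA.Term (Empty ⊕ Fin k)) {φ : LA.BoundedFormula Empty (k + 1)},
      motive φ → motive (bdAll t φ))
    {k : ℕ} {φ : LA.BoundedFormula Empty k} (h : IsSigma (j + 1) φ) : motive φ := by
  refine IsSigma.rec (motive_1 := fun n {k} φ _ => n = j + 1 → motive φ)
    (motive_2 := fun _ {_} _ _ => True) ?_ ?_ ?_ ?_ ?_ ?_ ?_ ?_ ?_ ?_ ?_ ?_ h rfl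
  · intro k φ _ h; cases h
  · intro n k φ h _ e; cases e; exact ofPi h
  · intro n k φ _ ih e; exact ex (ih e)
  · intro n k φ ψ _ _ ih₁ ih₂ e; exact inf (ih₁ e) (ih₂ e)
  · intro n k φ ψ _ _ ih₁ ih₂ e; exact sup (ih₁ e) (ih₂ e)
  · intro n k t φ _ ih e; exact bdall t (ih e)
  all_goals intros; trivial

theorem IsPi.succ_induction {j : ℕ}
    {motive : ∀ {k : ℕ}, LA.BoundedFormula Empty k → Prop}
    (ofSigma : ∀ {k : ℕ} {φ : LA.BoundedFormula Empty k}, IsSigma j φ → motive φ)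
    (all : ∀ {k : ℕ} {φ : LA.BoundedFormula Empty (k + 1)}, motive φ → motive φ.all)
    (inf : ∀ {k : ℕ} {φ ψ : LA.BoundedFormula Empty k}, motive φ → motive ψ → motive (φ ⊓ ψ))
    (sup : ∀ {k : ℕ} {φ ψ : LA.BoundedFormula Empty k}, motive φ → motive ψ → motive (φ ⊔ ψ))
    (bdex : ∀ {k : ℕ} (t : LA.Term (Empty ⊕ Fin k)) {φ : LA.BoundedFormula Empty (k + 1)},
      motive φ → motive (bdEx t φ))
    {k : ℕ} {φ : LA.BoundedFormula Empty k} (h : IsPi (j + 1) φ) : motive φ := by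
  refine IsPi.rec (motive_2 := fun n {k} φ _ => n = j + 1 → motive φ)
    (motive_1 := fun _ {_} _ _ => True) ?_ ?_ ?_ ?_ ?_ ?_ ?_ ?_ ?_ ?_ ?_ ?_ h rfl
  iterate 6 (intros; trivial)
  · intro k φ _ h; cases h
  · intro n k φ h _ e; cases e; exact ofSigma h
  · intro n k φ _ ih e; exact all (ih e)
  · intro n k φ ψ _ _ ih₁ ih₂ e; exact inf (ih₁ e) (ih₂ e)
  · intro n k φ ψ _ _ ih₁ ih₂ e; exact sup (ih₁ e) (ih₂ e)
  · intro n k t φ _ ih e; exact bdex t (ih e)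

theorem isSigma_succ_and_isPi_succ (j : ℕ) :
    (∀ {k : ℕ} {φ : LA.BoundedFormula Empty k}, IsSigma j φ → IsSigma (j + 1) φ) ∧
      ∀ {k : ℕ} {φ : LA.BoundedFormula Empty k}, IsPi j φ → IsPi (j + 1) φ := by
  induction j with
  | zero =>
    exact ⟨fun h => .ofPi (.ofDelta0 (IsSigma.zero_iff.1 h)),
      fun h => .ofSigma (.ofDelta0 (IsPi.zero_iff.1 h))⟩
  | succ j ih =>
    exact ⟨IsSigma.succ_induction (fun h => .ofPi (ih.2 h)) .ex .inf .sup .bdall,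
      IsPi.succ_induction (fun h => .ofSigma (ih.1 h)) .all .inf .sup .bdex⟩

theorem IsSigma.mono {i j k : ℕ} {φ : LA.BoundedFormula Empty k} (hij : i ≤ j)
    (h : IsSigma i φ) : IsSigma j φ :=
  Nat.le_induction h (fun m _ ih => (isSigma_succ_and_isPi_succ m).1 ih) j hij

theorem IsPi.mono {i j k : ℕ} {φ : LA.BoundedFormula Empty k} (hij : i ≤ j)
    (h : IsPi i φ) : IsPi j φ :=
  Nat.le_induction h (fun m _ ih => (isSigma_succ_and_isPi_succ m).2 ih) j hij

theorem Delta0.isSigma {j k : ℕ} {φ : LA.BoundedFormula Empty k} (h : Delta0 φ) : IsSigma j φ :=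
  (IsSigma.ofDelta0 h).mono j.zero_le

theorem Delta0.isPi {j k : ℕ} {φ : LA.BoundedFormula Empty k} (h : Delta0 φ) : IsPi j φ :=
  (IsPi.ofDelta0 h).mono j.zero_le

theorem isSigma_ren_and_isPi_ren (j : ℕ) :
    (∀ {k : ℕ} {φ : LA.BoundedFormula Empty k}, IsSigma j φ →
      ∀ {k' : ℕ} (f : Fin k → Fin k'), IsSigma j (ren f φ)) ∧
    ∀ {k : ℕ} {φ : LA.BoundedFormula Empty k}, IsPi j φ →
      ∀ {k' : ℕ} (f : Fin k → Fin k'), IsPi j (ren f φ) := by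
  induction j with
  | zero =>
    exact ⟨fun h _ f => .ofDelta0 ((IsSigma.zero_iff.1 h).ren f),
      fun h _ f => .ofDelta0 ((IsPi.zero_iff.1 h).ren f)⟩
  | succ j ih =>
    constructor
    · refine IsSigma.succ_induction
        (motive := fun {k} φ => ∀ {k' : ℕ} (f : Fin k → Fin k'), IsSigma (j + 1) (GRNonRE.ren f φ))
        (fun h _ f => .ofPi (ih.2 h f))
        (fun h _ f => .ex (h (extRen f))) (fun h₁ h₂ _ f => .inf (h₁ f) (h₂ f))
        (fun h₁ h₂ _ f => .sup (h₁ f) (h₂ f)) (fun t _ h _ f => ?_)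
      have := IsSigma.bdall (t.relabel (Sum.map id f)) (h (extRen f))
      rwa [← ren_leF_last] at this
    · refine IsPi.succ_induction
        (motive := fun {k} φ => ∀ {k' : ℕ} (f : Fin k → Fin k'), IsPi (j + 1) (GRNonRE.ren f φ))
        (fun h _ f => .ofSigma (ih.1 h f))
        (fun h _ f => .all (h (extRen f))) (fun h₁ h₂ _ f => .inf (h₁ f) (h₂ f))
        (fun h₁ h₂ _ f => .sup (h₁ f) (h₂ f)) (fun t _ h _ f => ?_)
      have := IsPi.bdex (t.relabel (Sum.map id f)) (h (extRen f))
      rwa [← ren_leF_last] at this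

theorem IsSigma.ren {j k k' : ℕ} {φ : LA.BoundedFormula Empty k} (h : IsSigma j φ)
    (f : Fin k → Fin k') : IsSigma j (ren f φ) := (isSigma_ren_and_isPi_ren j).1 h f

theorem IsPi.ren {j k k' : ℕ} {φ : LA.BoundedFormula Empty k} (h : IsPi j φ)
    (f : Fin k → Fin k') : IsPi j (ren f φ) := (isSigma_ren_and_isPi_ren j).2 h f

/-! ### Models of Peano arithmetic -/

/-- `M` is a model of `PA`. -/
def PAModel (M : Type) [LA.Structure M] : Prop := ∀ σ ∈ PATheory, M ⊨ σ

section Induction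

variable {M : Type} [LA.Structure M] {k : ℕ}

theorem sat_alls (φ : LA.BoundedFormula Empty k) :
    M ⊨ φ.alls ↔ ∀ v : Fin k → M, Sat φ v := by
  unfold Sentence.Realize
  rw [realize_alls]
  simp only [realize_iff_sat]

theorem realize_toFormula_iff_sat (φ : LA.BoundedFormula Empty k) (e : Empty ⊕ Fin k → M)
    (w : Fin 0 → M) : BoundedFormula.Realize φ.toFormula e w ↔ Sat φ (e ∘ Sum.inr) := by
  rw [Subsingleton.elim w default]
  exact (realize_toFormula φ e).trans (realize_iff_sat _ _)

theorem sat_substLast_zeroT (φ : LA.BoundedFormula Empty (k + 1)) (v : Fin k → M) :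
    Sat (substLast φ zeroT) v ↔ Sat φ (Fin.snoc v (zeroM M)) := by
  unfold Sat substLast
  rw [realize_relabel, realize_subst, realize_toFormula_iff_sat, Sat, iff_eq_eq]
  congr 1; ext i
  refine Fin.lastCases ?_ (fun i => ?_) i
  · simp [zeroT, Term.realize, zeroM]
    congr 1; ext i; exact i.elim0
  · simp

theorem sat_succLast (φ : LA.BoundedFormula Empty (k + 1)) (v : Fin k → M) (x : M) :
    Sat (succLast φ) (Fin.snoc v x) ↔ Sat φ (Fin.snoc v (succM x)) := by
  unfold Sat succLast
  rw [realize_relabel, realize_subst, realize_toFormula_iff_sat, Sat, iff_eq_eq]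
  congr 1; ext i
  refine Fin.lastCases ?_ (fun i => ?_) i
  · simp [succT, Term.realize, succM]
    congr 1; ext i; fin_cases i; simp
  · simp

theorem models_indAx_iff (φ : LA.BoundedFormula Empty (k + 1)) :
    M ⊨ indAx φ ↔ ∀ v : Fin k → M, Sat φ (Fin.snoc v (zeroM M)) →
      (∀ x : M, Sat φ (Fin.snoc v x) → Sat φ (Fin.snoc v (succM x))) →
      ∀ x : M, Sat φ (Fin.snoc v x) := by
  rw [indAx, sat_alls]
  simp only [sat_imp, sat_inf, sat_all, sat_substLast_zeroT, sat_succLast, and_imp]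

end Induction

namespace PAModel

variable {M : Type} [LA.Structure M]

theorem induction (hM : PAModel M) {k : ℕ} (φ : LA.BoundedFormula Empty (k + 1)) (v : Fin k → M)
    (h0 : Sat φ (Fin.snoc v (zeroM M)))
    (hs : ∀ x : M, Sat φ (Fin.snoc v x) → Sat φ (Fin.snoc v (succM x))) (x : M) :
    Sat φ (Fin.snoc v x) :=
  (models_indAx_iff φ).1 (hM _ (Or.inr ⟨k, φ, rfl⟩)) v h0 hs x

theorem sat_of_mem (hM : PAModel M) {σ : LA.Sentence} (h : σ ∈ QTheory) :
    Sat σ (default : Fin 0 → M) :=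
  (models_iff_sat σ).1 (hM _ (Or.inl h))

theorem succ_ne_zero (hM : PAModel M) (x : M) : succM x ≠ zeroM M := by
  have h := hM.sat_of_mem (σ := ∀' ∼(succT (&0) =' zeroT)) (by simp [QTheory])
  simpa [Fin.snoc] using sat_all.1 h x

theorem succ_inj (hM : PAModel M) {x y : M} (e : succM x = succM y) : x = y := by
  have h := hM.sat_of_mem (σ := ∀' ∀' ((succT (&0) =' succT (&1)) ⟹ (&0 =' &1)))
    (by simp [QTheory])
  simpa [Fin.snoc, e] using sat_all.1 (sat_all.1 h x) y

theorem exists_eq_succ (hM : PAModel M) {x : M} (hx : x ≠ zeroM M) : ∃ y, x = succM y := by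
  have h := hM.sat_of_mem (σ := ∀' (∼(&0 =' zeroT) ⟹ ∃' (&0 =' succT (&1))))
    (by simp [QTheory])
  simpa [Fin.snoc, hx, -sat_imp] using sat_imp.1 (sat_all.1 h x)

theorem add_zero (hM : PAModel M) (x : M) : addM x (zeroM M) = x := by
  have h := hM.sat_of_mem (σ := ∀' (addT (&0) zeroT =' &0)) (by simp [QTheory])
  simpa [Fin.snoc] using sat_all.1 h x

theorem add_succ (hM : PAModel M) (x y : M) : addM x (succM y) = succM (addM x y) := by
  have h := hM.sat_of_mem (σ := ∀' ∀' (addT (&0) (succT (&1)) =' succT (addT (&0) (&1))))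
    (by simp [QTheory])
  simpa [Fin.snoc] using sat_all.1 (sat_all.1 h x) y

theorem mul_zero (hM : PAModel M) (x : M) : mulM x (zeroM M) = zeroM M := by
  have h := hM.sat_of_mem (σ := ∀' (mulT (&0) zeroT =' zeroT)) (by simp [QTheory])
  simpa [Fin.snoc] using sat_all.1 h x

theorem mul_succ (hM : PAModel M) (x y : M) : mulM x (succM y) = addM (mulM x y) x := by
  have h := hM.sat_of_mem
    (σ := ∀' ∀' (mulT (&0) (succT (&1)) =' addT (mulT (&0) (&1)) (&0))) (by simp [QTheory])
  simpa [Fin.snoc] using sat_all.1 (sat_all.1 h x) y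

theorem le_iff (hM : PAModel M) (x y : M) : leM x y ↔ ∃ z, addM z x = y := by
  have h := hM (((leF (&0) (&1) ⇔ ∃' (addT (&2) (&0) =' (&1)) :
    LA.BoundedFormula Empty 2)).alls) (Or.inl (by simp [QTheory]))
  simpa [Fin.snoc] using (sat_alls _).1 h ![x, y]

theorem zero_add (hM : PAModel M) (x : M) : addM (zeroM M) x = x := by
  have := hM.induction (k := 0) (addT zeroT (&0) =' &0) default
    (by simpa [Fin.snoc] using hM.add_zero _)
    (fun x hx => by
      have hx : addM (zeroM M) x = x := by simpa [Fin.snoc] using hx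
      simp [Fin.snoc, hM.add_succ, hx]) x
  simpa [Fin.snoc] using this

theorem succ_add (hM : PAModel M) (x y : M) : addM (succM x) y = succM (addM x y) := by
  have := hM.induction (k := 1) (addT (succT (&0)) (&1) =' succT (addT (&0) (&1))) ![x]
    (by simp [hM.add_zero])
    (fun y hy => by
      have hy : addM (succM x) y = succM (addM x y) := by simpa [Fin.snoc] using hy
      simp [hM.add_succ, hy]) y
  simpa [Fin.snoc] using this

theorem add_comm (hM : PAModel M) (x y : M) : addM x y = addM y x := by
  have := hM.induction (k := 1) (addT (&0) (&1) =' addT (&1) (&0)) ![x]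
    (by simp [hM.add_zero, hM.zero_add])
    (fun y hy => by
      have hy : addM x y = addM y x := by simpa [Fin.snoc] using hy
      simp [hM.add_succ, hM.succ_add, hy]) y
  simpa [Fin.snoc] using this

theorem add_assoc (hM : PAModel M) (x y z : M) : addM (addM x y) z = addM x (addM y z) := by
  have := hM.induction (k := 2) (addT (addT (&0) (&1)) (&2) =' addT (&0) (addT (&1) (&2))) ![x, y]
    (by simp [hM.add_zero])
    (fun z hz => by
      have hz : addM (addM x y) z = addM x (addM y z) := by simpa [Fin.snoc] using hz
      simp [hM.add_succ, hz]) z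
  simpa [Fin.snoc] using this

theorem le_refl (hM : PAModel M) (x : M) : leM x x := (hM.le_iff x x).2 ⟨zeroM M, hM.zero_add x⟩

theorem le_trans (hM : PAModel M) {x y z : M} (h₁ : leM x y) (h₂ : leM y z) : leM x z := by
  obtain ⟨a, rfl⟩ := (hM.le_iff x y).1 h₁
  obtain ⟨b, rfl⟩ := (hM.le_iff _ z).1 h₂
  exact (hM.le_iff _ _).2 ⟨addM b a, hM.add_assoc _ _ _⟩

theorem le_add_left (hM : PAModel M) (x y : M) : leM x (addM y x) := (hM.le_iff _ _).2 ⟨y, rfl⟩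

theorem le_add_right (hM : PAModel M) (x y : M) : leM x (addM x y) :=
  (hM.le_iff _ _).2 ⟨y, hM.add_comm _ _⟩

theorem le_zero_iff (hM : PAModel M) {x : M} : leM x (zeroM M) ↔ x = zeroM M := by
  refine ⟨fun h => ?_, fun h => h ▸ hM.le_refl x⟩
  by_contra hx
  obtain ⟨y, rfl⟩ := hM.exists_eq_succ hx
  obtain ⟨z, hz⟩ := (hM.le_iff _ _).1 h
  rw [hM.add_succ] at hz
  exact hM.succ_ne_zero _ hz

theorem le_succ_iff (hM : PAModel M) {x y : M} : leM x (succM y) ↔ leM x y ∨ x = succM y := by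
  constructor
  · intro h
    obtain ⟨z, hz⟩ := (hM.le_iff _ _).1 h
    by_cases hz0 : z = zeroM M
    · subst hz0
      rw [hM.zero_add] at hz
      exact Or.inr hz
    · obtain ⟨w, rfl⟩ := hM.exists_eq_succ hz0
      rw [hM.succ_add] at hz
      exact Or.inl ((hM.le_iff _ _).2 ⟨w, hM.succ_inj hz⟩)
  · rintro (h | rfl)
    · obtain ⟨z, rfl⟩ := (hM.le_iff _ _).1 h
      exact (hM.le_iff _ _).2 ⟨succM z, hM.succ_add _ _⟩
    · exact hM.le_refl _

end PAModel

/-! ### Bounded quantifiers and collection -/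

section

variable {M : Type} [LA.Structure M] {k : ℕ}

theorem sat_bdAll (t : LA.Term (Empty ⊕ Fin k)) (φ : LA.BoundedFormula Empty (k + 1))
    (v : Fin k → M) :
    Sat (bdAll t φ) v ↔ ∀ x : M, leM x (tval t v) → Sat φ (Fin.snoc v x) := by
  simp

theorem sat_bdEx (t : LA.Term (Empty ⊕ Fin k)) (φ : LA.BoundedFormula Empty (k + 1))
    (v : Fin k → M) :
    Sat (bdEx t φ) v ↔ ∃ x : M, leM x (tval t v) ∧ Sat φ (Fin.snoc v x) := by
  simp

end

theorem snoc_comp_castSucc {M : Type} {k : ℕ} (v : Fin k → M) (x : M) :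
    (Fin.snoc v x : Fin (k + 1) → M) ∘ Fin.castSucc = v := by
  ext i; simp

theorem PAModel.collection {M : Type} [LA.Structure M] (hM : PAModel M) {k : ℕ}
    (φ : LA.BoundedFormula Empty (k + 2)) (v : Fin k → M) (a : M)
    (h : ∀ x : M, leM x a → ∃ y : M, Sat φ (Fin.snoc (Fin.snoc v x) y)) :
    ∃ b : M, ∀ x : M, leM x a → ∃ y : M, leM y b ∧ Sat φ (Fin.snoc (Fin.snoc v x) y) := by
  have key := hM.induction (k := k)
    (bdAll (&(Fin.last k)) (ren (extRen (extRen Fin.castSucc)) φ).ex ⟹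
      (bdAll (&(Fin.last k).castSucc)
        (bdEx (&(Fin.last (k + 1)).castSucc)
          (ren (extRen (extRen (Fin.castSucc ∘ Fin.castSucc))) φ))).ex) v
  simp only [sat_imp, sat_ex, sat_all, sat_inf, sat_leF, tval_liftT, sat_ren, snoc_comp_extRen,
    tval_var, Fin.snoc_last, Fin.snoc_castSucc, ← Function.comp_assoc, snoc_comp_castSucc] at key
  refine key ?_ ?_ a h
  · intro h0
    obtain ⟨y, hy⟩ := h0 (zeroM M) (hM.le_refl _)
    refine ⟨y, fun x hx => ?_⟩
    rw [hM.le_zero_iff] at hx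
    exact ⟨y, hM.le_refl y, hx ▸ hy⟩
  · intro w ih hw
    obtain ⟨b, hb⟩ := ih fun x hx => hw x (hM.le_succ_iff.2 (Or.inl hx))
    obtain ⟨y, hy⟩ := hw (succM w) (hM.le_refl _)
    refine ⟨addM b y, fun x hx => ?_⟩
    rcases hM.le_succ_iff.1 hx with hx | rfl
    · obtain ⟨z, hz, hφ⟩ := hb x hx
      exact ⟨z, hM.le_trans hz (hM.le_add_right _ _), hφ⟩
    · exact ⟨y, hM.le_add_left _ _, hy⟩

/-! ### Numerals and the standard model -/

/-- The value of the `m`-th numeral in `M`. -/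
def numM (M : Type) [LA.Structure M] : ℕ → M
  | 0 => zeroM M
  | m + 1 => succM (numM M m)

@[simp] theorem zeroM_nat : zeroM ℕ = 0 := rfl
@[simp] theorem succM_nat (x : ℕ) : succM x = x + 1 := rfl
@[simp] theorem addM_nat (x y : ℕ) : addM x y = x + y := rfl
@[simp] theorem mulM_nat (x y : ℕ) : mulM x y = x * y := rfl
@[simp] theorem leM_nat (x y : ℕ) : leM x y ↔ x ≤ y := Iff.rfl

@[simp] theorem numM_nat (m : ℕ) : numM ℕ m = m := by
  induction m with
  | zero => rfl
  | succ m ih => simp [numM, ih]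

theorem numM_nat_comp {k : ℕ} (v : Fin k → ℕ) : numM ℕ ∘ v = v := by
  ext i; simp

theorem paModel_nat : PAModel ℕ := by
  rintro σ (hσ | ⟨k, φ, rfl⟩)
  · simp only [QTheory, Set.mem_insert_iff, Set.mem_singleton_iff] at hσ
    rcases hσ with rfl | rfl | rfl | rfl | rfl | rfl | rfl | rfl
    iterate 7
      rw [models_iff_sat]
      simp [Fin.snoc]
      try grind
    rw [sat_alls]
    intro v
    simp [Fin.snoc]
    exact ⟨fun h => ⟨v 1 - v 0, by omega⟩, fun ⟨z, hz⟩ => by omega⟩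
  · rw [models_indAx_iff]
    intro v h0 hs x
    induction x with
    | zero => exact h0
    | succ x ih => exact hs x ih

namespace PAModel

variable {M : Type} [LA.Structure M]

theorem numM_add (hM : PAModel M) (a b : ℕ) : numM M (a + b) = addM (numM M a) (numM M b) := by
  induction b with
  | zero => simp [numM, hM.add_zero]
  | succ b ih => rw [← _root_.add_assoc, numM, numM, hM.add_succ, ih]

theorem numM_mul (hM : PAModel M) (a b : ℕ) : numM M (a * b) = mulM (numM M a) (numM M b) := by
  induction b with
  | zero => simp [numM, hM.mul_zero]
  | succ b ih => rw [Nat.mul_succ, numM, hM.mul_succ, hM.numM_add, ih]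

theorem numM_injective (hM : PAModel M) : Function.Injective (numM M) := by
  intro a
  induction a with
  | zero =>
    rintro (_ | b) h
    · rfl
    · exact absurd h.symm (hM.succ_ne_zero _)
  | succ a ih =>
    rintro (_ | b) h
    · exact absurd h (hM.succ_ne_zero _)
    · rw [ih (hM.succ_inj h)]

theorem le_numM_iff (hM : PAModel M) {x : M} {m : ℕ} :
    leM x (numM M m) ↔ ∃ i ≤ m, x = numM M i := by
  induction m with
  | zero => simp [numM, hM.le_zero_iff]
  | succ m ih =>
    rw [numM, hM.le_succ_iff, ih]
    constructor
    · rintro (⟨i, hi, rfl⟩ | rfl)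
      · exact ⟨i, by omega, rfl⟩
      · exact ⟨m + 1, le_rfl, rfl⟩
    · rintro ⟨i, hi, rfl⟩
      rcases Nat.le_succ_iff.1 hi with hi | rfl
      · exact Or.inl ⟨i, hi, rfl⟩
      · exact Or.inr rfl

theorem numM_le_numM_iff (hM : PAModel M) {a b : ℕ} : leM (numM M a) (numM M b) ↔ a ≤ b := by
  rw [hM.le_numM_iff]
  constructor
  · rintro ⟨i, hi, e⟩
    exact hM.numM_injective e ▸ hi
  · exact fun h => ⟨a, h, rfl⟩

theorem tval_numM_comp (hM : PAModel M) {k : ℕ} (t : LA.Term (Empty ⊕ Fin k)) (v : Fin k → ℕ) :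
    tval t (numM M ∘ v) = numM M (tval t v) := by
  induction t with
  | var i =>
    rcases i with e | i
    · exact e.elim
    · rfl
  | func f ts ih =>
    cases f with
    | zero =>
      have : (Term.func ArithFunc.zero ts : LA.Term (Empty ⊕ Fin k)) = zeroT := by
        unfold zeroT; congr 1; ext i; exact i.elim0
      erw [this]; simp [numM]
    | succ =>
      have : (Term.func ArithFunc.succ ts : LA.Term (Empty ⊕ Fin k)) = succT (ts 0) := by
        unfold succT; congr 1; ext i; fin_cases i; rfl
      erw [this]; simp [numM, ih]
    | add =>
      have : (Term.func ArithFunc.add ts : LA.Term (Empty ⊕ Fin k)) = addT (ts 0) (ts 1) := by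
        unfold addT; congr 1; ext i; fin_cases i <;> rfl
      erw [this]; simp [ih, hM.numM_add]
    | mul =>
      have : (Term.func ArithFunc.mul ts : LA.Term (Empty ⊕ Fin k)) = mulT (ts 0) (ts 1) := by
        unfold mulT; congr 1; ext i; fin_cases i <;> rfl
      erw [this]; simp [ih, hM.numM_mul]

/-- Bounded formulas are absolute between `ℕ` and models of `PA`. -/
theorem sat_numM_iff_of_delta0 (hM : PAModel M) {k : ℕ} {φ : LA.BoundedFormula Empty k}
    (h : Delta0 φ) (v : Fin k → ℕ) : Sat φ (numM M ∘ v) ↔ Sat φ v := by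
  induction h with
  | falsum => rfl
  | equal t s => simp only [sat_eq, hM.tval_numM_comp, hM.numM_injective.eq_iff]
  | le t s => simp only [sat_leF, hM.tval_numM_comp, hM.numM_le_numM_iff, leM_nat]
  | imp _ _ ih₁ ih₂ => simp only [sat_imp, ih₁, ih₂]
  | bdall t _ ih =>
    rw [sat_bdAll, sat_bdAll, hM.tval_numM_comp]
    simp only [leM_nat, ← ih, hM.le_numM_iff, Fin.comp_snoc]
    exact ⟨fun h x hx => h _ ⟨x, hx, rfl⟩, by rintro h _ ⟨x, hx, rfl⟩; exact h x hx⟩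

end PAModel

/-! ### Equivalence over `PA` and normal forms -/

/-- Equivalence of formulas in all models of `PA`. -/
def PAEquiv {k : ℕ} (φ ψ : LA.BoundedFormula Empty k) : Prop :=
  ∀ (M : Type) [LA.Structure M], PAModel M → ∀ v : Fin k → M, Sat φ v ↔ Sat ψ v

/-- Equivalence over `PA` to a `Σⱼ`-formula. -/
def EqvSigma (j : ℕ) {k : ℕ} (φ : LA.BoundedFormula Empty k) : Prop :=
  ∃ ψ, IsSigma j ψ ∧ PAEquiv φ ψ

/-- Equivalence over `PA` to a `Πⱼ`-formula. -/
def EqvPi (j : ℕ) {k : ℕ} (φ : LA.BoundedFormula Empty k) : Prop :=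
  ∃ ψ, IsPi j ψ ∧ PAEquiv φ ψ

theorem IsPi.eqvPi {j k : ℕ} {φ : LA.BoundedFormula Empty k} (h : IsPi j φ) : EqvPi j φ :=
  ⟨φ, h, fun _ _ _ _ => Iff.rfl⟩

theorem Delta0.not {k : ℕ} {φ : LA.BoundedFormula Empty k} (h : Delta0 φ) : Delta0 (∼φ) :=
  .imp h .falsum

theorem Delta0.inf {k : ℕ} {φ ψ : LA.BoundedFormula Empty k} (h₁ : Delta0 φ) (h₂ : Delta0 ψ) :
    Delta0 (φ ⊓ ψ) :=
  .not (.imp h₁ h₂.not)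

theorem Delta0.sup {k : ℕ} {φ ψ : LA.BoundedFormula Empty k} (h₁ : Delta0 φ) (h₂ : Delta0 ψ) :
    Delta0 (φ ⊔ ψ) :=
  .imp h₁.not h₂

theorem EqvPi.inf {j k : ℕ} {φ ψ : LA.BoundedFormula Empty k} (h₁ : EqvPi j φ)
    (h₂ : EqvPi j ψ) : EqvPi j (φ ⊓ ψ) := by
  obtain ⟨φ', hφ, e₁⟩ := h₁
  obtain ⟨ψ', hψ, e₂⟩ := h₂
  refine ⟨φ' ⊓ ψ', ?_, fun M _ hM v => by simp [e₁ M hM, e₂ M hM]⟩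
  cases j with
  | zero => exact .ofDelta0 ((IsPi.zero_iff.1 hφ).inf (IsPi.zero_iff.1 hψ))
  | succ j => exact .inf hφ hψ

theorem EqvPi.sup {j k : ℕ} {φ ψ : LA.BoundedFormula Empty k} (h₁ : EqvPi j φ)
    (h₂ : EqvPi j ψ) : EqvPi j (φ ⊔ ψ) := by
  obtain ⟨φ', hφ, e₁⟩ := h₁
  obtain ⟨ψ', hψ, e₂⟩ := h₂
  refine ⟨φ' ⊔ ψ', ?_, fun M _ hM v => by simp [e₁ M hM, e₂ M hM]⟩
  cases j with
  | zero => exact .ofDelta0 ((IsPi.zero_iff.1 hφ).sup (IsPi.zero_iff.1 hψ))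
  | succ j => exact .sup hφ hψ

theorem EqvPi.bdAll {j k : ℕ} (t : LA.Term (Empty ⊕ Fin k)) {φ : LA.BoundedFormula Empty (k + 1)}
    (h : EqvPi j φ) : EqvPi j (bdAll t φ) := by
  obtain ⟨φ', hφ, e⟩ := h
  cases j with
  | zero =>
    exact ⟨GRNonRE.bdAll t φ', .ofDelta0 (.bdall t (IsPi.zero_iff.1 hφ)),
      fun M _ hM v => by simp [e M hM]⟩
  | succ j =>
    refine ⟨(∼(leF (&(Fin.last k)) (liftT t)) ⊔ φ').all,
      .all (.sup (Delta0.isPi (.not (.le _ _))) hφ), fun M _ hM v => ?_⟩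
    simp [e M hM, imp_iff_not_or]

theorem EqvPi.bdEx {j k : ℕ} (t : LA.Term (Empty ⊕ Fin k)) {φ : LA.BoundedFormula Empty (k + 1)}
    (h : EqvPi j φ) : EqvPi j (bdEx t φ) := by
  obtain ⟨φ', hφ, e⟩ := h
  cases j with
  | zero =>
    exact ⟨∼(GRNonRE.bdAll t (∼φ')), .ofDelta0 (.not (.bdall t (.not (IsPi.zero_iff.1 hφ)))),
      fun M _ hM v => by simp [e M hM]⟩
  | succ j => exact ⟨GRNonRE.bdEx t φ', .bdex t hφ, fun M _ hM v => by simp [e M hM]⟩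

theorem isSigma_not_and_isPi_not (j : ℕ) :
    (∀ {k : ℕ} {φ : LA.BoundedFormula Empty k}, IsSigma j φ → EqvPi j (∼φ)) ∧
      ∀ {k : ℕ} {φ : LA.BoundedFormula Empty k}, IsPi j φ → EqvSigma j (∼φ) := by
  induction j with
  | zero =>
    exact ⟨fun h => ⟨_, .ofDelta0 (IsSigma.zero_iff.1 h).not, fun _ _ _ _ => Iff.rfl⟩,
      fun h => ⟨_, .ofDelta0 (IsPi.zero_iff.1 h).not, fun _ _ _ _ => Iff.rfl⟩⟩
  | succ j ih =>
    constructor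
    · refine IsSigma.succ_induction (motive := fun {k} φ => EqvPi (j + 1) (∼φ)) ?_ ?_ ?_ ?_ ?_
      · intro k φ h
        obtain ⟨ψ, hψ, e⟩ := ih.2 h
        exact ⟨ψ, .ofSigma hψ, e⟩
      · rintro k φ ⟨ψ, hψ, e⟩
        exact ⟨ψ.all, .all hψ, fun M _ hM v => by simp [← e M hM]⟩
      · rintro k φ₁ φ₂ ⟨ψ₁, h₁, e₁⟩ ⟨ψ₂, h₂, e₂⟩
        exact ⟨ψ₁ ⊔ ψ₂, .sup h₁ h₂, fun M _ hM v => by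
          simp [← e₁ M hM, ← e₂ M hM, imp_iff_not_or]⟩
      · rintro k φ₁ φ₂ ⟨ψ₁, h₁, e₁⟩ ⟨ψ₂, h₂, e₂⟩
        exact ⟨ψ₁ ⊓ ψ₂, .inf h₁ h₂, fun M _ hM v => by simp [← e₁ M hM, ← e₂ M hM]⟩
      · rintro k t φ ⟨ψ, hψ, e⟩
        exact ⟨bdEx t ψ, .bdex t hψ, fun M _ hM v => by simp [← e M hM]⟩
    · refine IsPi.succ_induction (motive := fun {k} φ => EqvSigma (j + 1) (∼φ)) ?_ ?_ ?_ ?_ ?_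
      · intro k φ h
        obtain ⟨ψ, hψ, e⟩ := ih.1 h
        exact ⟨ψ, .ofPi hψ, e⟩
      · rintro k φ ⟨ψ, hψ, e⟩
        exact ⟨ψ.ex, .ex hψ, fun M _ hM v => by simp [← e M hM]⟩
      · rintro k φ₁ φ₂ ⟨ψ₁, h₁, e₁⟩ ⟨ψ₂, h₂, e₂⟩
        exact ⟨ψ₁ ⊔ ψ₂, .sup h₁ h₂, fun M _ hM v => by
          simp [← e₁ M hM, ← e₂ M hM, imp_iff_not_or]⟩
      · rintro k φ₁ φ₂ ⟨ψ₁, h₁, e₁⟩ ⟨ψ₂, h₂, e₂⟩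
        exact ⟨ψ₁ ⊓ ψ₂, .inf h₁ h₂, fun M _ hM v => by simp [← e₁ M hM, ← e₂ M hM]⟩
      · rintro k t φ ⟨ψ, hψ, e⟩
        exact ⟨bdAll t ψ, .bdall t hψ, fun M _ hM v => by simp [← e M hM]⟩

theorem IsPi.eqvSigma_not {j k : ℕ} {φ : LA.BoundedFormula Empty k} (h : IsPi j φ) :
    EqvSigma j (∼φ) := (isSigma_not_and_isPi_not j).2 h

/-- `φ` is equivalent over `PA` to `∃ z, ψ` with `ψ` equivalent to a `Πⱼ`-formula. -/
def HasPiMatrix (j : ℕ) {k : ℕ} (φ : LA.BoundedFormula Empty k) : Prop :=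
  ∃ ψ : LA.BoundedFormula Empty (k + 1), EqvPi j ψ ∧ PAEquiv φ ψ.ex

theorem hasPiMatrix_of_isSigma {j k : ℕ} {φ : LA.BoundedFormula Empty k} (h : IsSigma (j + 1) φ) :
    HasPiMatrix j φ := by
  refine IsSigma.succ_induction (motive := fun {k} φ => HasPiMatrix j φ) ?_ ?_ ?_ ?_ ?_ h
  · intro k φ h
    refine ⟨ren Fin.castSucc φ, (h.ren _).eqvPi, fun M _ hM v => ?_⟩
    simp only [sat_ex, sat_ren, snoc_comp_castSucc]
    exact ⟨fun h => ⟨zeroM M, h⟩, fun ⟨_, h⟩ => h⟩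
  · rintro k φ ⟨ψ, ⟨ψ', hψ, e'⟩, e⟩
    refine ⟨bdEx (&(Fin.last k)) (bdEx (&(Fin.last k).castSucc)
      (ren (extRen (extRen Fin.castSucc)) ψ')), .bdEx _ (.bdEx _ (hψ.ren _).eqvPi),
      fun M _ hM v => ?_⟩
    simp only [sat_ex, e M hM, e' M hM, sat_inf, sat_leF, tval_liftT, sat_ren, snoc_comp_extRen,
      tval_var, Fin.snoc_last, Fin.snoc_castSucc, snoc_comp_castSucc]
    constructor
    · rintro ⟨x, z, h⟩
      exact ⟨addM x z, x, hM.le_add_right _ _, z, hM.le_add_left _ _, h⟩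
    · rintro ⟨w, x, _, z, _, h⟩
      exact ⟨x, z, h⟩
  · rintro k φ₁ φ₂ ⟨ψ₁, ⟨ψ₁', h₁, e₁'⟩, e₁⟩ ⟨ψ₂, ⟨ψ₂', h₂, e₂'⟩, e₂⟩
    refine ⟨bdEx (&(Fin.last k)) (ren (extRen Fin.castSucc) ψ₁') ⊓
      bdEx (&(Fin.last k)) (ren (extRen Fin.castSucc) ψ₂'),
      .inf (.bdEx _ (h₁.ren _).eqvPi) (.bdEx _ (h₂.ren _).eqvPi), fun M _ hM v => ?_⟩
    simp only [sat_ex, e₁ M hM, e₁' M hM, e₂ M hM, e₂' M hM, sat_inf, sat_leF, tval_liftT, sat_ren,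
      snoc_comp_extRen, tval_var, Fin.snoc_last, snoc_comp_castSucc]
    constructor
    · rintro ⟨⟨x, hx⟩, ⟨y, hy⟩⟩
      exact ⟨addM x y, ⟨x, hM.le_add_right _ _, hx⟩, ⟨y, hM.le_add_left _ _, hy⟩⟩
    · rintro ⟨w, ⟨x, _, hx⟩, ⟨y, _, hy⟩⟩
      exact ⟨⟨x, hx⟩, ⟨y, hy⟩⟩
  · rintro k φ₁ φ₂ ⟨ψ₁, h₁, e₁⟩ ⟨ψ₂, h₂, e₂⟩
    refine ⟨ψ₁ ⊔ ψ₂, h₁.sup h₂, fun M _ hM v => ?_⟩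
    simp only [sat_ex, e₁ M hM, e₂ M hM, sat_sup, exists_or]
  · rintro k t φ ⟨ψ, ⟨ψ', hψ, e'⟩, e⟩
    refine ⟨bdAll (liftT t) (bdEx (&(Fin.last k).castSucc)
      (ren (extRen (extRen Fin.castSucc)) ψ')), .bdAll _ (.bdEx _ (hψ.ren _).eqvPi),
      fun M _ hM v => ?_⟩
    simp only [sat_ex, sat_all, sat_imp, e M hM, e' M hM, sat_inf, sat_leF, tval_liftT, sat_ren,
      snoc_comp_extRen, tval_var, Fin.snoc_last, Fin.snoc_castSucc, snoc_comp_castSucc]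
    constructor
    · exact hM.collection ψ' v (tval t v)
    · rintro ⟨b, h⟩ x hx
      obtain ⟨y, _, hy⟩ := h x hx
      exact ⟨y, hy⟩

theorem IsSigma.exists_pi_matrix {j k : ℕ} {φ : LA.BoundedFormula Empty k}
    (h : IsSigma (j + 1) φ) :
    ∃ ψ : LA.BoundedFormula Empty (k + 1), IsPi j ψ ∧ PAEquiv φ ψ.ex := by
  obtain ⟨ψ, ⟨θ, hθ, e₂⟩, e₁⟩ := hasPiMatrix_of_isSigma h
  exact ⟨θ, hθ, fun M _ hM v => by simp [e₁ M hM, e₂ M hM]⟩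

/-! ### Numerical instances of formulas -/

/-- The `m`-th numeral as a term in context `k`. -/
def numT (k : ℕ) : ℕ → LA.Term (Empty ⊕ Fin k)
  | 0 => zeroT
  | m + 1 => succT (numT k m)

@[simp] theorem tval_numT {M : Type} [LA.Structure M] {k : ℕ} (m : ℕ) (v : Fin k → M) :
    tval (numT k m) v = numM M m := by
  induction m with
  | zero => simp [numT, numM]
  | succ m ih => simp [numT, numM, ih]

/-- The formula `φ` with numerals for the values `v` plugged in, up to equivalence over `PA`. -/
def instNum : ∀ {k : ℕ}, LA.BoundedFormula Empty k → (Fin k → ℕ) → LA.Sentence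
  | 0, φ, _ => φ
  | k + 1, φ, v =>
    instNum (bdEx (numT k (v (Fin.last k)))
      (((&(Fin.last k)) =' numT (k + 1) (v (Fin.last k))) ⊓ φ))
      (v ∘ Fin.castSucc)

theorem PAModel.sat_instNum {M : Type} [LA.Structure M] (hM : PAModel M) {k : ℕ}
    (φ : LA.BoundedFormula Empty k) (v : Fin k → ℕ) :
    Sat (instNum φ v) (default : Fin 0 → M) ↔ Sat φ (numM M ∘ v) := by
  induction k with
  | zero => rw [instNum, Subsingleton.elim (default : Fin 0 → M)]
  | succ k ih =>
    have hv : numM M ∘ v = Fin.snoc (numM M ∘ v ∘ Fin.castSucc) (numM M (v (Fin.last k))) := by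
      ext i
      refine Fin.lastCases ?_ (fun i => ?_) i <;> simp
    rw [instNum, ih, sat_bdEx, hv]
    simp only [sat_inf, sat_eq, tval_var, Fin.snoc_last, tval_numT]
    constructor
    · rintro ⟨_, _, rfl, h⟩
      exact h
    · exact fun h => ⟨_, hM.le_refl _, rfl, h⟩

theorem IsPi.instNum {j k : ℕ} {φ : LA.BoundedFormula Empty k} (h : IsPi (j + 1) φ)
    (v : Fin k → ℕ) : IsPi (j + 1) (instNum φ v) := by
  induction k with
  | zero => exact h
  | succ k ih => exact ih (.bdex _ (.inf (Delta0.isPi (.equal _ _)) h)) _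

theorem IsSigma.instNum {j k : ℕ} {φ : LA.BoundedFormula Empty k} (h : IsSigma (j + 1) φ)
    (v : Fin k → ℕ) : IsSigma (j + 1) (instNum φ v) := by
  induction k with
  | zero => exact h
  | succ k ih =>
    exact ih (.ex (.inf (Delta0.isSigma (.le _ _)) (.inf (Delta0.isSigma (.equal _ _)) h))) _

theorem sat_subst1 {M : Type} [LA.Structure M] (ψ : LA.BoundedFormula Empty 1) (m : ℕ) :
    Sat (subst1 ψ m) (default : Fin 0 → M) ↔ Sat ψ (fun _ => numM M m) := by
  have hnum : ∀ e : Empty → M, (numeral m).realize e = numM M m := by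
    intro e
    induction m with
    | zero =>
      simp only [numeral, zeroT, Term.realize, numM, zeroM]; congr 1; ext i; exact i.elim0
    | succ m ih =>
      simp only [numeral, succT, Term.realize, numM, succM, ← ih]
      congr 1; ext i; fin_cases i; rfl
  rw [subst1, Sat, realize_subst, realize_toFormula_iff_sat, iff_eq_eq]
  congr 1; ext i; exact hnum _

/-! ### Provability of numerical instances -/

/-- The numerical instance `φ(v)` holds in all models of `T`. -/
def ProvesAt (T : LA.Theory) {k : ℕ} (φ : LA.BoundedFormula Empty k) (v : Fin k → ℕ) : Prop :=
  ∀ M : Theory.ModelType.{0, 0, 0} T, Sat φ (numM M ∘ v)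

theorem proves_iff_sat {T : LA.Theory} {σ : LA.Sentence} :
    Proves T σ ↔ ∀ M : Theory.ModelType.{0, 0, 0} T, Sat σ (default : Fin 0 → M) := by
  rw [Proves, Theory.models_sentence_iff]
  exact forall_congr' fun M => models_iff_sat σ

theorem paModel_of_proves {T : LA.Theory} (hPA : ∀ φ ∈ PATheory, Proves T φ)
    (M : Theory.ModelType.{0, 0, 0} T) : PAModel M :=
  fun σ hσ => Theory.models_sentence_iff.1 (hPA σ hσ) M

theorem proves_instNum_iff {T : LA.Theory} (hPA : ∀ φ ∈ PATheory, Proves T φ) {k : ℕ}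
    {φ : LA.BoundedFormula Empty k} {v : Fin k → ℕ} :
    Proves T (instNum φ v) ↔ ProvesAt T φ v :=
  proves_iff_sat.trans
    (forall_congr' fun M => (paModel_of_proves hPA M).sat_instNum φ v)

theorem ProvesAt.congr {T : LA.Theory} (hPA : ∀ φ ∈ PATheory, Proves T φ) {k : ℕ}
    {φ ψ : LA.BoundedFormula Empty k} {v : Fin k → ℕ} (e : PAEquiv φ ψ) :
    ProvesAt T φ v ↔ ProvesAt T ψ v :=
  forall_congr' fun M => e M (paModel_of_proves hPA M) _

/-- Every true instance of a `Πⱼ`-formula is provable. -/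
def PiComplete (T : LA.Theory) (j : ℕ) : Prop :=
  ∀ {k : ℕ} {φ : LA.BoundedFormula Empty k}, IsPi j φ → ∀ v : Fin k → ℕ, Sat φ v → ProvesAt T φ v

/-- Every true instance of a `Σⱼ`-formula is provable. -/
def SigmaComplete (T : LA.Theory) (j : ℕ) : Prop :=
  ∀ {k : ℕ} {φ : LA.BoundedFormula Empty k}, IsSigma j φ → ∀ v : Fin k → ℕ, Sat φ v →
    ProvesAt T φ v

theorem PiComplete.sigmaComplete_succ {T : LA.Theory} (hPA : ∀ φ ∈ PATheory, Proves T φ) {j : ℕ}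
    (h : PiComplete T j) : SigmaComplete T (j + 1) := by
  refine IsSigma.succ_induction
    (motive := fun {k} φ => ∀ v : Fin k → ℕ, Sat φ v → ProvesAt T φ v) h ?_ ?_ ?_ ?_
  · intro k φ ih v hv M
    obtain ⟨x, hx⟩ := sat_ex.1 hv
    have := ih _ hx M
    rw [Fin.comp_snoc] at this
    exact sat_ex.2 ⟨_, this⟩
  · intro k φ ψ ih₁ ih₂ v hv M
    have hv := sat_inf.1 hv
    exact sat_inf.2 ⟨ih₁ v hv.1 M, ih₂ v hv.2 M⟩
  · intro k φ ψ ih₁ ih₂ v hv M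
    exact sat_sup.2 ((sat_sup.1 hv).imp (ih₁ v · M) (ih₂ v · M))
  · intro k t φ ih v hv M
    have hM := paModel_of_proves hPA M
    rw [sat_bdAll] at hv ⊢
    rw [hM.tval_numM_comp]
    intro x hx
    obtain ⟨i, hi, rfl⟩ := hM.le_numM_iff.1 hx
    have := ih _ (hv i hi) M
    rwa [Fin.comp_snoc] at this

theorem SigmaComplete.sound {T : LA.Theory} (hPA : ∀ φ ∈ PATheory, Proves T φ) {n j : ℕ}
    (hcon : NCon (n + 1) T) (hj : j ≤ n) (hc : SigmaComplete T j) {k : ℕ}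
    {θ : LA.BoundedFormula Empty k} (hθ : IsSigma (j + 1) θ) {v : Fin k → ℕ}
    (hp : ProvesAt T θ v) : Sat θ v := by
  obtain ⟨ψ, hψ, e⟩ := (hθ.instNum v).exists_pi_matrix
  by_contra hfalse
  have hpsi : ∀ m : ℕ, ¬ Sat ψ (fun _ => m) := by
    intro m hm
    apply hfalse
    rw [← numM_nat_comp v, ← paModel_nat.sat_instNum, e ℕ paModel_nat, sat_ex]
    refine ⟨m, ?_⟩
    convert hm using 1
    ext i; fin_cases i; rfl
  refine hcon ⟨ψ, hψ.mono hj, fun m => ?_, ?_⟩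
  · obtain ⟨θ', hθ', e'⟩ := hψ.eqvSigma_not
    have h := (ProvesAt.congr hPA e').2
      (hc hθ' (fun _ => m) ((e' ℕ paModel_nat _).1 (sat_not.2 (hpsi m))))
    rw [proves_iff_sat]
    intro M
    rw [sat_not, sat_subst1]
    exact sat_not.1 (h M)
  · rw [proves_iff_sat]
    intro M
    exact (e M (paModel_of_proves hPA M) _).1 (proves_iff_sat.1 ((proves_instNum_iff hPA).2 hp) M)

theorem complete_of_decides {T : LA.Theory} (hPA : ∀ φ ∈ PATheory, Proves T φ) {n : ℕ}
    (hcon : NCon (n + 1) T)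
    (hdec : ∀ γ : LA.Sentence, IsPi n γ → Proves T γ ∨ Proves T (∼γ)) :
    ∀ j ≤ n, PiComplete T j ∧ SigmaComplete T j := by
  intro j
  induction j with
  | zero =>
    intro _
    constructor
    · intro k φ h v hv M
      exact ((paModel_of_proves hPA M).sat_numM_iff_of_delta0 (IsPi.zero_iff.1 h) v).2 hv
    · intro k φ h v hv M
      exact ((paModel_of_proves hPA M).sat_numM_iff_of_delta0 (IsSigma.zero_iff.1 h) v).2 hv
  | succ j ih =>
    intro hj
    obtain ⟨hpi, hsigma⟩ := ih (by omega)
    refine ⟨?_, hpi.sigmaComplete_succ hPA⟩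
    intro k φ h v hv
    rcases hdec _ ((h.instNum v).mono hj) with hp | hp
    · exact (proves_instNum_iff hPA).1 hp
    · obtain ⟨θ, hθ, e⟩ := h.eqvSigma_not
      have hnot : ProvesAt T (∼φ) v := fun M => by
        have := proves_iff_sat.1 hp M
        rw [sat_not, (paModel_of_proves hPA M).sat_instNum] at this
        exact sat_not.2 this
      have := hsigma.sound hPA hcon (by omega) hθ ((ProvesAt.congr hPA e).1 hnot)
      exact absurd hv (sat_not.1 ((e ℕ paModel_nat v).2 this))

/-- If an `(n+1)`-consistent extension of `PA` decides all `Πₙ`-sentences, then it proves exactly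
the true `Σₙ₊₁`-sentences. -/
theorem proves_iff_of_decides {T : LA.Theory} (hPA : ∀ φ ∈ PATheory, Proves T φ) {n : ℕ}
    (hcon : NCon (n + 1) T)
    (hdec : ∀ γ : LA.Sentence, IsPi n γ → Proves T γ ∨ Proves T (∼γ))
    {σ : LA.Sentence} (hσ : IsSigma (n + 1) σ) :
    Proves T σ ↔ Sat σ (default : Fin 0 → ℕ) := by
  obtain ⟨hpi, hsigma⟩ := complete_of_decides hPA hcon hdec n le_rfl
  have hp : Proves T σ ↔ ProvesAt T σ default := proves_instNum_iff (φ := σ) (v := default) hPA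
  rw [hp]
  exact ⟨hsigma.sound hPA hcon le_rfl hσ, hpi.sigmaComplete_succ hPA hσ _⟩

/-! ### Relations on the standard model definable by `Σ₁`-formulas -/

/-- A relation on `ℕ` definable by a `Σ₁`-formula. -/
def SigmaRel {k : ℕ} (R : (Fin k → ℕ) → Prop) : Prop :=
  ∃ φ : LA.BoundedFormula Empty k, IsSigma 1 φ ∧ ∀ v, Sat φ v ↔ R v

/-- A function on `ℕ` whose graph is definable by a `Σ₁`-formula. -/
def SigmaFun {k : ℕ} (f : (Fin k → ℕ) → ℕ) : Prop :=
  SigmaRel fun v : Fin (k + 1) → ℕ => v (Fin.last k) = f (v ∘ Fin.castSucc)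

namespace SigmaRel

variable {k : ℕ}

theorem congr {R S : (Fin k → ℕ) → Prop} (hR : SigmaRel R) (h : ∀ v, S v ↔ R v) : SigmaRel S := by
  obtain ⟨φ, hφ, e⟩ := hR
  exact ⟨φ, hφ, fun v => (e v).trans (h v).symm⟩

theorem and {R S : (Fin k → ℕ) → Prop} (hR : SigmaRel R) (hS : SigmaRel S) :
    SigmaRel fun v => R v ∧ S v := by
  obtain ⟨φ, hφ, e⟩ := hR
  obtain ⟨ψ, hψ, e'⟩ := hS
  exact ⟨φ ⊓ ψ, .inf hφ hψ, fun v => by simp [e, e']⟩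

theorem or {R S : (Fin k → ℕ) → Prop} (hR : SigmaRel R) (hS : SigmaRel S) :
    SigmaRel fun v => R v ∨ S v := by
  obtain ⟨φ, hφ, e⟩ := hR
  obtain ⟨ψ, hψ, e'⟩ := hS
  exact ⟨φ ⊔ ψ, .sup hφ hψ, fun v => by simp [e, e']⟩

theorem ex {R : (Fin k → ℕ) → ℕ → Prop}
    (hR : SigmaRel fun v : Fin (k + 1) → ℕ => R (v ∘ Fin.castSucc) (v (Fin.last k))) :
    SigmaRel fun v => ∃ x, R v x := by
  obtain ⟨φ, hφ, e⟩ := hR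
  exact ⟨φ.ex, .ex hφ, fun v => by simp [e]⟩

theorem tval_eq (t s : LA.Term (Empty ⊕ Fin k)) : SigmaRel fun v => tval t v = tval s v :=
  ⟨t =' s, Delta0.isSigma (.equal _ _), fun _ => sat_eq t s⟩

theorem var_le (i j : Fin k) : SigmaRel fun v => v i ≤ v j :=
  ⟨leF (&i) (&j), Delta0.isSigma (.le _ _), fun v => by simp⟩

theorem eq_comp {f : (Fin k → ℕ) → ℕ} (hf : SigmaFun f) {m : ℕ} (ρ : Fin k → Fin m) (i : Fin m) :
    SigmaRel fun v => v i = f (v ∘ ρ) := by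
  obtain ⟨φ, hφ, e⟩ := hf
  refine ⟨ren (Fin.snoc ρ i : Fin (k + 1) → Fin m) φ, hφ.ren _, fun v => ?_⟩
  rw [sat_ren, e, Fin.comp_snoc]
  beta_reduce
  rw [snoc_comp_castSucc, Fin.snoc_last]

end SigmaRel

namespace SigmaFun

variable {k : ℕ} {f g : (Fin k → ℕ) → ℕ}

theorem tval (t : LA.Term (Empty ⊕ Fin k)) : SigmaFun fun v => tval t v :=
  (SigmaRel.tval_eq (&(Fin.last k)) (t.relabel (Sum.map id Fin.castSucc))).congr
    fun v => by rw [tval_relabel, tval_var]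

theorem var (i : Fin k) : SigmaFun fun v => v i := tval (&i)

theorem const (c : ℕ) : SigmaFun fun _ : Fin k → ℕ => c :=
  (tval (numT k c)).congr fun v => by simp

theorem comp_castSucc (hf : SigmaFun f) :
    SigmaFun fun v : Fin (k + 1) → ℕ => f (v ∘ Fin.castSucc) :=
  SigmaRel.eq_comp hf (Fin.castSucc ∘ Fin.castSucc) (Fin.last (k + 1))

theorem eq (hf : SigmaFun f) (hg : SigmaFun g) : SigmaRel fun v => f v = g v :=
  (SigmaRel.ex (R := fun v x => x = f v ∧ x = g v)
    (.and (.eq_comp hf _ _) (.eq_comp hg _ _))).congr fun v => by simp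

theorem le (hf : SigmaFun f) (hg : SigmaFun g) : SigmaRel fun v => f v ≤ g v :=
  (SigmaRel.ex (R := fun v x => ∃ y, x = f v ∧ y = g v ∧ x ≤ y) <|
    SigmaRel.ex (R := fun w y => w (Fin.last k) = f (w ∘ Fin.castSucc) ∧
        y = g (w ∘ Fin.castSucc) ∧ w (Fin.last k) ≤ y) <|
      .and (.eq_comp hf (Fin.castSucc ∘ Fin.castSucc) (Fin.last k).castSucc)
        (.and (.eq_comp hg (Fin.castSucc ∘ Fin.castSucc) (Fin.last (k + 1)))
          (.var_le (Fin.last k).castSucc (Fin.last (k + 1))))).congr fun v => by simp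

/-- Substitution of definable functions in a term with two variables. -/
theorem tval₂ (t : LA.Term (Empty ⊕ Fin 2)) (hf : SigmaFun f) (hg : SigmaFun g) :
    SigmaFun fun v => GRNonRE.tval t ![f v, g v] :=
  (SigmaRel.ex (R := fun v x => ∃ y, x = f (v ∘ Fin.castSucc) ∧ y = g (v ∘ Fin.castSucc) ∧
      v (Fin.last k) = GRNonRE.tval t ![x, y]) <|
    SigmaRel.ex (R := fun w y => w (Fin.last (k + 1)) = f (w ∘ Fin.castSucc ∘ Fin.castSucc) ∧
      y = g (w ∘ Fin.castSucc ∘ Fin.castSucc) ∧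
        w (Fin.last k).castSucc = GRNonRE.tval t ![w (Fin.last (k + 1)), y]) <|
      .and (.eq_comp hf (Fin.castSucc ∘ Fin.castSucc ∘ Fin.castSucc) (Fin.last (k + 1)).castSucc)
        (.and (.eq_comp hg (Fin.castSucc ∘ Fin.castSucc ∘ Fin.castSucc) (Fin.last (k + 2)))
          ((SigmaRel.tval_eq (&(Fin.last k).castSucc.castSucc) (t.relabel (Sum.map id
            ![(Fin.last (k + 1)).castSucc, Fin.last (k + 2)]))).congr fun v => by
              rw [tval_relabel, tval_var]
              have : v ∘ ![(Fin.last (k + 1)).castSucc, Fin.last (k + 2)] =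
                  ![v (Fin.last (k + 1)).castSucc, v (Fin.last (k + 2))] := by
                ext i; fin_cases i <;> rfl
              rw [this]; rfl))).congr fun v => by simp

theorem add (hf : SigmaFun f) (hg : SigmaFun g) : SigmaFun fun v => f v + g v :=
  (tval₂ (addT (&0) (&1)) hf hg).congr fun v => by simp

theorem mul (hf : SigmaFun f) (hg : SigmaFun g) : SigmaFun fun v => f v * g v :=
  (tval₂ (mulT (&0) (&1)) hf hg).congr fun v => by simp

theorem succ (hf : SigmaFun f) : SigmaFun fun v => f v + 1 := hf.add (.const 1)

theorem lt (hf : SigmaFun f) (hg : SigmaFun g) : SigmaRel fun v => f v < g v := hf.succ.le hg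

theorem pair (hf : SigmaFun f) (hg : SigmaFun g) : SigmaFun fun v => Nat.pair (f v) (g v) :=
  (SigmaRel.or
    ((hf.comp_castSucc.lt hg.comp_castSucc).and
      ((var (Fin.last k)).eq ((hg.comp_castSucc.mul hg.comp_castSucc).add hf.comp_castSucc)))
    ((hg.comp_castSucc.le hf.comp_castSucc).and
      ((var (Fin.last k)).eq
        (((hf.comp_castSucc.mul hf.comp_castSucc).add hf.comp_castSucc).add
          hg.comp_castSucc)))).congr fun v => by
    unfold Nat.pair; beta_reduce; split <;> omega

theorem mod_succ (hf : SigmaFun f) (hg : SigmaFun g) : SigmaFun fun v => f v % (g v + 1) :=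
  (SigmaRel.and ((var (Fin.last k)).le hg.comp_castSucc)
    (SigmaRel.ex (R := fun v q => f (v ∘ Fin.castSucc) =
        (g (v ∘ Fin.castSucc) + 1) * q + v (Fin.last k))
      (hf.comp_castSucc.comp_castSucc.eq
        ((hg.comp_castSucc.comp_castSucc.succ.mul (var (Fin.last (k + 1)))).add
          (var (Fin.last k).castSucc))))).congr fun v => by
    constructor
    · intro h
      rw [h]
      exact ⟨Nat.lt_succ_iff.1 (Nat.mod_lt _ (Nat.succ_pos _)), _, (Nat.div_add_mod _ _).symm⟩
    · rintro ⟨h, q, e⟩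
      beta_reduce
      rw [e, Nat.mul_add_mod, Nat.mod_eq_of_lt (Nat.lt_succ_iff.2 h)]

theorem ball {R : (Fin k → ℕ) → ℕ → Prop} (hf : SigmaFun f)
    (hR : SigmaRel fun v : Fin (k + 1) → ℕ => R (v ∘ Fin.castSucc) (v (Fin.last k))) :
    SigmaRel fun v => ∀ x < f v, R v x := by
  obtain ⟨φ, hφ, e⟩ := hR
  have hb : SigmaRel fun w : Fin (k + 1) → ℕ =>
      ∀ x ≤ w (Fin.last k), w (Fin.last k) ≤ x ∨ R (w ∘ Fin.castSucc) x := by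
    refine ⟨bdAll (&(Fin.last k)) (leF (&(Fin.last k).castSucc) (&(Fin.last (k + 1))) ⊔
      ren (extRen Fin.castSucc) φ),
      .bdall _ (.sup (Delta0.isSigma (.le _ _)) (hφ.ren _)), fun w => ?_⟩
    rw [sat_bdAll]
    simp only [sat_sup, sat_leF, sat_ren, snoc_comp_extRen, tval_var, Fin.snoc_last,
      Fin.snoc_castSucc, e, snoc_comp_castSucc, leM_nat]
  refine (SigmaRel.ex (R := fun v b => b = f v ∧ ∀ x ≤ b, b ≤ x ∨ R v x)
    (.and (.eq_comp hf _ _) hb)).congr fun v => ?_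
  simp only [exists_eq_left]
  exact ⟨fun h x hx => (hx.lt_or_eq).symm.imp (fun e => e.ge) (h x),
    fun h x hx => (h x hx.le).resolve_left (not_le.2 hx)⟩

/-- Definability of functions given by iteration. -/
theorem iter {h step : ℕ → ℕ} (h_succ : ∀ m, h (m + 1) = step (h m))
    (hstep : ∀ {k : ℕ} {f : (Fin k → ℕ) → ℕ}, SigmaFun f → SigmaFun fun v => step (f v))
    (hf : SigmaFun f) : SigmaFun fun v => h (f v) := by
  have hB : ∀ {m : ℕ} {a b i : (Fin m → ℕ) → ℕ}, SigmaFun a → SigmaFun b → SigmaFun i →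
      SigmaFun fun v => a v % ((i v + 1) * b v + 1) :=
    fun ha hb hi => ha.mod_succ (hi.succ.mul hb)
  have hf₂ := hf.comp_castSucc.comp_castSucc.comp_castSucc
  have ha : SigmaFun fun v : Fin (k + 3) → ℕ => v (Fin.last (k + 1)).castSucc := var _
  have hb : SigmaFun fun v : Fin (k + 3) → ℕ => v (Fin.last (k + 2)) := var _
  have hi : SigmaFun fun v : Fin (k + 4) → ℕ => v (Fin.last (k + 3)) := var _
  refine (SigmaRel.ex (R := fun v a => ∃ b, a % ((0 + 1) * b + 1) = h 0 ∧
    (∀ i < f (v ∘ Fin.castSucc),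
      a % ((i + 1 + 1) * b + 1) = step (a % ((i + 1) * b + 1))) ∧
    v (Fin.last k) = a % ((f (v ∘ Fin.castSucc) + 1) * b + 1)) <|
    SigmaRel.ex <| .and ((hB ha hb (.const 0)).eq (.const _)) <| .and
      (ball hf₂ <| (hB ha.comp_castSucc hb.comp_castSucc hi.succ).eq
        (hstep (hB ha.comp_castSucc hb.comp_castSucc hi)))
      ((var (Fin.last k).castSucc.castSucc).eq (hB ha hb hf₂))).congr fun v => ?_
  constructor
  · intro e
    let l : List ℕ := (List.range (f (v ∘ Fin.castSucc) + 1)).map h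
    have hl : ∀ i ≤ f (v ∘ Fin.castSucc),
        (Nat.unbeta l).unpair.1 % ((i + 1) * (Nat.unbeta l).unpair.2 + 1) = h i := by
      intro i hi
      have := Nat.beta_unbeta_coe l ⟨i, by simp [l]; omega⟩
      simpa [Nat.beta, l] using this
    refine ⟨(Nat.unbeta l).unpair.1, (Nat.unbeta l).unpair.2, hl 0 (Nat.zero_le _),
      fun i hi => ?_, ?_⟩
    · rw [hl (i + 1) hi, hl i hi.le, h_succ]
    · rw [hl _ le_rfl, e]
  · rintro ⟨a, b, h0, hs, e⟩
    have : ∀ i ≤ f (v ∘ Fin.castSucc), a % ((i + 1) * b + 1) = h i := by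
      intro i
      induction i with
      | zero => exact fun _ => h0
      | succ i ih => intro hi; rw [hs i hi, ih (by omega), h_succ]
    rw [e, this _ le_rfl]

end SigmaFun

/-! ### Diagonalization -/

/-- The formula `∃ z, z = ē ∧ χ(z)`. -/
def diagInst (χ : LA.BoundedFormula Empty 1) (e : ℕ) : LA.Sentence :=
  (((&0) =' numT 1 e) ⊓ χ).ex

/-- The part of the symbol list of `diagInst χ e` that follows the numeral `ē`. -/
def diagTail (χ : LA.BoundedFormula Empty 1) :
    List ((Σ k, LA.Term (Empty ⊕ Fin k)) ⊕ ((Σ n, LA.Relations n) ⊕ ℕ)) :=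
  (∼χ).listEncode ++ (⊥ : LA.BoundedFormula Empty 1).listEncode ++
    (⊥ : LA.BoundedFormula Empty 1).listEncode ++ (⊥ : LA.BoundedFormula Empty 0).listEncode

/-- The part of the symbol list of `diagInst χ e` that precedes the numeral `ē`. -/
def diagHead : List ((Σ k, LA.Term (Empty ⊕ Fin k)) ⊕ ((Σ n, LA.Relations n) ⊕ ℕ)) :=
  [.inr (.inr 0), .inr (.inr 1), .inr (.inr 0), .inr (.inr 0), .inr (.inr 0), .inl ⟨1, &0⟩]

theorem listEncode_diagInst (χ : LA.BoundedFormula Empty 1) (e : ℕ) :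
    (diagInst χ e).listEncode = diagHead ++ (.inl ⟨1, numT 1 e⟩ :: diagTail χ) := by
  change ((((((&0) =' numT 1 e) ⟹ ∼χ) ⟹ ⊥) ⟹ ⊥).all ⟹ ⊥ : LA.Sentence).listEncode = _
  simp [listEncode, diagHead, diagTail, Term.bdEqual]

/-- The Gödel number of `diagInst χ z` when `z` is the code of `diagTail χ`. -/
def diagCode (z : ℕ) : ℕ :=
  diagHead.foldr (fun a c => Nat.pair (Encodable.encode a) c + 1)
    (Nat.pair (2 * Nat.pair 1 (Encodable.encode (numT 1 z))) z + 1)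

theorem godel_diagInst (χ : LA.BoundedFormula Empty 1) :
    godel (diagInst χ (Encodable.encode (diagTail χ))) =
      diagCode (Encodable.encode (diagTail χ)) := by
  rw [godel, listEncode_diagInst, diagCode]
  induction diagHead with
  | nil =>
    simp only [List.nil_append, List.foldr_nil, Encodable.encode_list_cons, Encodable.encode_inl,
      Encodable.encode_sigma_val, Encodable.encode_nat, Nat.succ_eq_add_one]
  | cons a l ih => rw [List.cons_append, Encodable.encode_list_cons, ih]; rfl

theorem sigmaFun_diagCode : SigmaFun fun v : Fin 1 → ℕ => diagCode (v 0) := by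
  have hnum : SigmaFun fun v : Fin 1 → ℕ => Encodable.encode (numT 1 (v 0)) := by
    refine SigmaFun.iter (h := fun z => Encodable.encode (numT 1 z))
      (step := fun c => Nat.pair (Encodable.encode
        (Sum.inr ⟨1, ArithFunc.succ⟩ : (Empty ⊕ Fin 1) ⊕ (Σ i, LA.Functions i))) c + 1)
      (fun m => ?_) (fun hf => ((SigmaFun.const _).pair hf).succ) (.var 0)
    have hl : (numT 1 (m + 1)).listEncode =
        Sum.inr ⟨1, ArithFunc.succ⟩ :: (numT 1 m).listEncode := by
      simp [numT, succT, Term.listEncode, List.finRange_succ]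
    change Encodable.encode (numT 1 (m + 1)).listEncode = _
    rw [hl, Encodable.encode_list_cons]
    rfl
  unfold diagCode
  induction diagHead with
  | nil =>
    exact ((((SigmaFun.const 2).mul ((SigmaFun.const 1).pair hnum))).pair (.var 0)).succ
  | cons a l ih => exact ((SigmaFun.const _).pair ih).succ

theorem godel_injective : Function.Injective (godel : LA.Sentence → ℕ) := by
  intro φ ψ h
  have := listEncode_sigma_injective (a₁ := ⟨0, φ⟩) (a₂ := ⟨0, ψ⟩) (Encodable.encode_injective h)
  simpa using this

/-- The diagonal lemma in the standard model. -/
theorem exists_diagonal {j : ℕ} {Ψ : LA.BoundedFormula Empty 1} (hΨ : IsSigma (j + 1) Ψ) :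
    ∃ σ : LA.Sentence, IsSigma (j + 1) σ ∧
      (Sat σ (default : Fin 0 → ℕ) ↔ Sat Ψ (fun _ => godel σ)) := by
  obtain ⟨F, hF, e⟩ := sigmaFun_diagCode
  let χ : LA.BoundedFormula Empty 1 := (ren (fun _ => 1) Ψ ⊓ F).ex
  have hχ : IsSigma (j + 1) χ := .ex (.inf (hΨ.ren _) (hF.mono (by omega)))
  refine ⟨diagInst χ (Encodable.encode (diagTail χ)),
    .ex (.inf (Delta0.isSigma (.equal _ _)) hχ), ?_⟩
  rw [godel_diagInst]
  generalize Encodable.encode (diagTail χ) = c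
  simp only [diagInst, χ, sat_ex, sat_inf, sat_eq, tval_var, tval_numT, numM_nat, sat_ren, e]
  simp [Fin.snoc, Function.comp_def]

/-- **Corollary 1.3.** If the deductive closure of an `n`-consistent extension
of `PA` is `Πₙ`-definable (`n ≥ 2`), then it has an independent
`Π_{n-1}`-sentence. -/
theorem independent_sentence_of_nconsistent_piDefinable_closure
    (n : ℕ) (hn : 2 ≤ n) (T : LA.Theory)
    (hPA : ∀ φ ∈ PATheory, Proves T φ)
    (hcon : NCon n T)
    (hdef : PiDefinable n (theoremCodes T)) :
    ∃ γ : LA.Sentence, IsPi (n - 1) γ ∧ ¬ Proves T γ ∧ ¬ Proves T (∼γ) := by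
  obtain ⟨n, rfl⟩ : ∃ p, n = p + 1 := ⟨n - 1, by omega⟩
  obtain ⟨Ψ, hΨ, hdef⟩ := hdef
  by_contra hind
  have hdec : ∀ γ : LA.Sentence, IsPi n γ → Proves T γ ∨ Proves T (∼γ) := by
    intro γ hγ
    by_contra h
    exact hind ⟨γ, hγ, fun hp => h (Or.inl hp), fun hp => h (Or.inr hp)⟩
  obtain ⟨Ψ', hΨ', e⟩ := hΨ.eqvSigma_not
  obtain ⟨σ, hσ, hdiag⟩ := exists_diagonal hΨ'
  have hmem : godel σ ∈ theoremCodes T ↔ Proves T σ :=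
    ⟨fun ⟨φ, hφ, h⟩ => godel_injective h ▸ hφ, fun h => ⟨σ, h, rfl⟩⟩
  have hcode : Sat Ψ (fun _ => godel σ) ↔ Proves T σ := by
    rw [← hmem, hdef, Matrix.vec_single_eq_const]
    rfl
  rw [← e ℕ paModel_nat, sat_not, hcode, ← proves_iff_of_decides hPA hcon hdec hσ] at hdiag
  exact iff_not_self hdiag

end GRNonRE
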